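/- arXiv:2604.21818 — 2 statements merged into one kernel-verified Lean document; each statement's English description precedes it below -/
import Mathlib

section
/- Suppose A^π*S is r-nilpotent, i.e. (A^π*S)^r = 0, and that A^e*Y*A^π*S = 0. Then S has a Drazin inverse, given by S^D = Σ_{i=0}^{r−2} S^i*A^π*S*(X^{i+2} − X^{i+3}*Y*A^π) + X − X^2*Y*A^π. -/
open Matrix Finset

/-- `X` is a Drazin inverse of the square matrix `M`: `X*M*X = X`, `M*X = X*M`,
and `M^(l+1)*X = M^l` for some natural number `l`. -/
def IsDrazinInverse {n : Type*} [Fintype n] [DecidableEq n]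
    (M X : Matrix n n ℂ) : Prop :=
  X * M * X = X ∧ M * X = X * M ∧ ∃ l : ℕ, M ^ (l + 1) * X = M ^ l

theorem drz_aux {R : Type*} [Ring R] (e S X Q : R) (r l : ℕ)
    (he : e * e = e) (hX1 : e * X = X) (hX2 : X * e = X)
    (a1 : X * S * X = X) (a2 : e * S * X = X * S * e)
    (a3 : (e * S * e) ^ (l + 1) * X = (e * S * e) ^ l)
    (hQ : Q = (1 - e) * S) (hnil : Q ^ r = 0) (hc : e * S * Q = 0)
    (Z : R) (hZ : Z = ∑ i ∈ Finset.range r, Q ^ i * (X ^ (i + 2) * S)) :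
    Z * S * Z = Z ∧ S * Z = Z * S ∧ ∃ l : ℕ, S ^ (l + 1) * Z = S ^ l := by
  have hS : S = e * S + Q := by rw [hQ]; noncomm_ring
  have eQ : e * Q = 0 := by
    rw [hQ, ← mul_assoc, mul_sub, he]; simp
  have a4 : X * X * S * e = X := by
    rw [mul_assoc X X S, mul_assoc X, ← a2, ← mul_assoc, ← mul_assoc, hX2, a1]
  have eSS : e * S * S = e * S * (e * S) := by
    conv_lhs => rw [hS]
    rw [mul_add e, eQ, ← mul_assoc e e S, he, add_zero]
    conv_lhs => rw [mul_add, hc, add_zero]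
  have XSS : ∀ i, X ^ (i + 2) * S * S = X ^ (i + 1) * S := by
    intro i
    have h1 : X * S * S = X * S * e * S := by
      calc X * S * S = X * (e * S * S) := by
            rw [← mul_assoc, ← mul_assoc, hX2]
        _ = X * S * e * S := by rw [eSS]; simp only [← mul_assoc, hX2]
    calc X ^ (i + 2) * S * S = X ^ (i+1) * (X * S * S) := by
          rw [pow_succ _ (i+1)]; simp only [mul_assoc]
      _ = X ^ i * (X * X * S * e) * S := by
          rw [h1, pow_succ]; simp only [mul_assoc]
      _ = _ := by rw [a4, pow_succ]
  have eSZ : e * S * Z = X * S := by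
    rcases r with _ | r
    · have h0 : (1 : R) = 0 := by simpa using hnil
      rw [← mul_one (e * S * Z), ← mul_one (X * S), h0, mul_zero, mul_zero]
    rw [hZ, Finset.sum_range_succ', mul_add, Finset.mul_sum, Finset.sum_eq_zero]
    · simp only [pow_zero, one_mul, zero_add]
      rw [pow_two, ← mul_assoc, ← mul_assoc, a2, mul_assoc _ e X, hX1, a1]
    · intro i _
      rw [pow_succ' Q, mul_assoc Q, ← mul_assoc (e * S), hc, zero_mul]
  have ZS : Z * S = ∑ i ∈ Finset.range r, Q ^ i * (X ^ (i + 1) * S) := by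
    rw [hZ, Finset.sum_mul]
    refine Finset.sum_congr rfl fun i _ => ?_
    rw [mul_assoc, XSS]
  have SZ : S * Z = Z * S := by
    have h1 : S * Z = X * S + Q * Z := by
      conv_lhs => rw [hS]
      rw [add_mul, eSZ]
    rw [h1, ZS]
    have h2 := Finset.sum_range_succ' (fun i => Q ^ i * (X ^ (i + 1) * S)) r
    rw [Finset.sum_range_succ, hnil, zero_mul, add_zero] at h2
    rw [h2, hZ, Finset.mul_sum, add_comm]
    congr 1
    · refine Finset.sum_congr rfl fun i _ => ?_
      rw [pow_succ' Q, mul_assoc Q]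
    · simp
  refine ⟨?_, SZ, ?_⟩
  · rw [ZS]
    conv_rhs => rw [hZ]
    rw [Finset.sum_mul]
    refine Finset.sum_congr rfl fun i _ => ?_
    have h : X * S * Z = X * X * S := by
      have h9 : X * (X * S) = X * (e * S * Z) := by rw [eSZ]
      rw [mul_assoc X X, h9]; simp only [← mul_assoc, hX2]
    calc _ = Q ^ i * (X ^ i * (X * S * Z)) := by
          rw [pow_succ]; simp only [mul_assoc]
      _ = _ := by rw [h, pow_succ, pow_succ]; simp only [mul_assoc]
  · obtain ⟨W, hW⟩ : ∃ W, W = 1 - S * Z := ⟨_, rfl⟩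
    have hcW : Commute S W := by
      rw [hW]
      have : Commute S Z := SZ
      exact (Commute.one_right S).sub_right ((Commute.refl S).mul_right this)
    have p1 : ∀ k, e * S ^ (k + 1) = (e * S) ^ (k + 1) := by
      intro k
      induction k with
      | zero => simp
      | succ k ih =>
        rw [pow_succ, ← mul_assoc, ih, pow_succ, mul_assoc, mul_assoc, ← mul_assoc e S S, eSS,
          pow_succ _ (k+1), pow_succ _ k]
        simp only [mul_assoc]
    have p2 : ∀ k, (e * S) ^ k * e = (e * S * e) ^ k * e := by
      intro k
      induction k with
      | zero => simp
      | succ k ih =>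
        have : (e * S) * e = e * (e * S * e) := by
          simp only [← mul_assoc, he]
        have h3 : e * (e * S * e) = (e * S * e) * e := by
          simp only [← mul_assoc, he]; simp only [mul_assoc, he]
        calc _ = (e * S) ^ k * (e * S * e) := by rw [pow_succ, mul_assoc]
          _ = (e * S) ^ k * e * (e * S * e) := by rw [mul_assoc _ e, ← this]
          _ = (e * S * e) ^ k * (e * S * e * e) := by rw [ih, mul_assoc _ e, h3]
          _ = _ := by rw [pow_succ (e * S * e), mul_assoc ((e * S * e) ^ k)]
    have eSW : e * S * W = (1 - e * S * e * X) * (e * S) := by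
      have : e * S * (S * Z) = e * S * e * X * (e * S) := by
        rw [← mul_assoc, eSS, mul_assoc (e * S), eSZ, mul_assoc (e*S) e X, hX1, ← mul_assoc (e * S * X), mul_assoc (e*S) X e, hX2, mul_assoc]
        simp only [mul_assoc]
      rw [hW, mul_sub, this]; noncomm_ring
    have eV : e * (S ^ (l + 1) * W) = 0 := by
      have h5 : (1 - e * S * e * X) * (e * S) = e * ((1 - e * S * e * X) * (e * S)) := by
        simp only [mul_sub, sub_mul, one_mul, ← mul_assoc, he]
      rw [← mul_assoc, p1, pow_succ, mul_assoc, eSW, h5, ← mul_assoc, p2, mul_assoc, ← h5,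
        ← mul_assoc ((e * S * e) ^ l), mul_sub, mul_one, ← mul_assoc ((e * S * e) ^ l),
        ← pow_succ, a3, sub_self, zero_mul]
    have key : ∀ j, S ^ j * (S ^ (l + 1) * W) = Q ^ j * (S ^ (l + 1) * W) := by
      intro j
      have h6 : S * (S ^ (l + 1) * W) = Q * (S ^ (l + 1) * W) := by
        have : e * S * (S ^ (l + 1) * W) = 0 := by
          have hc2 : Commute S (S ^ (l + 1) * W) := ((Commute.refl S).pow_right _).mul_right hcW
          rw [mul_assoc, hc2.eq, ← mul_assoc, eV, zero_mul]
        conv_lhs => rw [hS, add_mul]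
        rw [← hS, this, zero_add]
      have hc2 : Commute S (S ^ (l + 1) * W) := ((Commute.refl S).pow_right _).mul_right hcW
      induction j with
      | zero => simp
      | succ j ih =>
        rw [pow_succ, mul_assoc, hc2.eq, ← mul_assoc, ih, mul_assoc, ← hc2.eq, h6, ← mul_assoc,
          ← pow_succ]
    refine ⟨r + (l + 1), ?_⟩
    have h7 := key r
    rw [hnil, zero_mul, ← mul_assoc, ← pow_add, hW, mul_sub, mul_one, ← mul_assoc, ← pow_succ] at h7
    exact (sub_eq_zero.mp h7).symm

theorem stmt2
    {p q : Type*} [Fintype p] [DecidableEq p] [Fintype q] [DecidableEq q]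
    (A AD : Matrix p p ℂ) (D DD : Matrix q q ℂ)
    (B : Matrix q p ℂ) (C : Matrix p q ℂ)
    (hA : IsDrazinInverse A AD) (hD : IsDrazinInverse D DD)
    (Y S Ae Aπ SAe : Matrix p p ℂ)
    (hY : Y = C * DD * B) (hS : S = A - Y)
    (hAe : Ae = A * AD) (hAπ : Aπ = 1 - A * AD)
    (hSAe : SAe = Ae * S * Ae)
    (X : Matrix p p ℂ) (hX : IsDrazinInverse SAe X)
    (r : ℕ) (hnil : (Aπ * S) ^ r = 0)
    (hcond : Ae * Y * Aπ * S = 0) :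
    IsDrazinInverse S
      ((∑ i ∈ Finset.range (r - 1),
          S ^ i * Aπ * S * (X ^ (i + 2) - X ^ (i + 3) * Y * Aπ))
        + X - X ^ 2 * Y * Aπ) := by
  obtain ⟨b1, b2, -⟩ := hA
  obtain ⟨c1, c2, l, c3⟩ := hX
  have he : Ae * Ae = Ae := by
    rw [hAe, mul_assoc, ← mul_assoc AD, b1]
  have hcA : Ae * A = A * Ae := by
    rw [hAe, mul_assoc, ← b2]
  have hf : Aπ = 1 - Ae := by rw [hAπ, hAe]
  have eAf : Ae * A * Aπ = 0 := by
    rw [hf, hcA, mul_sub, mul_one, mul_assoc, he, sub_self]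
  have eYf : Ae * Y * Aπ = - (Ae * S * Aπ) := by
    rw [hS, mul_sub, sub_mul, eAf]; simp
  have hX1 : Ae * X = X := by
    have : X = SAe * X * X := by rw [c2, c1]
    rw [this, hSAe]; simp only [← mul_assoc, he]
  have hX2 : X * Ae = X := by
    have : X = X * (X * SAe) := by rw [← c2, ← mul_assoc, c1]
    rw [this, hSAe]; simp only [mul_assoc, he]
  have a1 : X * S * X = X := by
    rw [hSAe] at c1
    simp only [← mul_assoc, hX2] at c1
    rwa [mul_assoc _ Ae X, hX1] at c1
  have a2 : Ae * S * X = X * S * Ae := by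
    rw [hSAe, mul_assoc _ Ae X, hX1] at c2
    simpa only [← mul_assoc, hX2] using c2
  have hc : Ae * S * (Aπ * S) = 0 := by
    have := hcond
    rw [eYf, neg_mul, neg_eq_zero] at this
    rw [← mul_assoc, this]
  have a4 : X * X * S * Ae = X := by
    rw [mul_assoc X X S, mul_assoc X, ← a2, ← mul_assoc, ← mul_assoc, hX2, a1]
  have XY : ∀ i, X ^ (i + 1) - X ^ (i + 2) * Y * Aπ = X ^ (i + 2) * S := by
    intro i
    have h1 : X ^ (i + 2) * Y * Aπ = - (X ^ (i + 2) * S * Aπ) := by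
      have h2 : X ^ (i + 2) * Ae = X ^ (i + 2) := by
        rw [pow_succ, mul_assoc, hX2]
      calc _ = X ^ (i + 2) * (Ae * Y * Aπ) := by
            rw [← h2]; simp only [mul_assoc]; rw [← mul_assoc Ae Ae, he]
        _ = _ := by
            rw [eYf, mul_neg]; simp only [← mul_assoc, h2]
    have h3 : X ^ (i + 2) * S * Ae = X ^ (i + 1) := by
      calc _ = X ^ i * (X * X * S * Ae) := by
            rw [pow_succ, pow_succ]; simp only [mul_assoc]
        _ = _ := by rw [a4, pow_succ]
    rw [h1, hf, mul_sub, h3, mul_one]; abel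
  have SQ : ∀ i, S ^ i * Aπ * S = (Aπ * S) ^ (i + 1) := by
    intro i
    induction i with
    | zero => simp
    | succ i ih =>
      have h1 : S * (Aπ * S) = Aπ * S * (Aπ * S) := by
        have : S = Ae * S + Aπ * S := by rw [hf]; noncomm_ring
        conv_lhs => rw [this, add_mul, ← this, hc, zero_add]
      calc _ = S ^ i * (S * (Aπ * S)) := by rw [pow_succ]; simp only [mul_assoc]
        _ = S ^ i * Aπ * S * (Aπ * S) := by rw [h1]; simp only [mul_assoc]
        _ = _ := by rw [ih, ← pow_succ]
  rw [hSAe] at c3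
  refine drz_aux Ae S X (Aπ * S) r l he hX1 hX2 a1 a2 c3 (by rw [hf]) hnil hc _ ?_
  rcases r with _ | r
  · have h0 : (1 : Matrix p p ℂ) = 0 := by simpa using hnil
    have h1 : ∀ M : Matrix p p ℂ, M = 0 := fun M => by rw [← mul_one M, h0, mul_zero]
    rw [h1 (_ - _), h1 (Finset.sum _ _)]
  · rw [Finset.sum_range_succ', Nat.add_sub_cancel, add_sub_assoc]
    congr 1
    · refine Finset.sum_congr rfl fun i _ => ?_
      rw [SQ, XY (i + 1)]
    · have := XY 0
      simpa using this
end

section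
/- Suppose K*D^π*Z^D*H = K*D^D*Z^π*H, let k be a natural number with A^(k+1)*A^D = A^k (so k is at least the index of A), and suppose S*A^π*Y = 0. Then S has a Drazin inverse, given by S^D = −Σ_{i=0}^{k−1} (1 − A^π*Y*T)*T^{i+2}*Y*A^π*A^i + T − A^π*Y*T^2. -/
open Matrix Finset

theorem aux_ring {R : Type*} [Ring R] (A P Y S T Q : R) (k : ℕ)
    (hS : S = A - Y) (hQ : Q = 1 - P) (hPP : P * P = P) (hAP : A * P = P * A)
    (hPT : P * T = T) (hTP : T * P = T) (h1 : P * S * T = P) (h2 : T * S * P = P)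
    (hk : A ^ k * Q = 0) (hc : S * Q * Y = 0) (X : R)
    (hX : X = -(∑ i ∈ Finset.range k, (1 - Q * Y * T) * T ^ (i + 2) * Y * Q * A ^ i)
        + T - Q * Y * T ^ 2) :
    X * S * X = X ∧ S * X = X * S ∧ S ^ (k + 1 + 1) * X = S ^ (k + 1) := by
  have hQP : Q * P = 0 := by rw [hQ, sub_mul, hPP]; simp
  have hPQ : P * Q = 0 := by rw [hQ, mul_sub, hPP]; simp
  have hQQ : Q * Q = Q := by
    calc Q * Q = Q * (1 - P) := by rw [← hQ]
      _ = Q := by rw [mul_sub, hQP]; simp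
  have hAQ : A * Q = Q * A := by rw [hQ, mul_sub, sub_mul, hAP]; simp
  have hAiQ : ∀ i, A ^ i * Q = Q * A ^ i := fun i =>
    (Commute.pow_left (show Commute A Q from hAQ) i)
  have hTQ : T * Q = 0 := by rw [← hTP, mul_assoc, hPQ, mul_zero]
  have hQT : Q * T = 0 := by rw [← hPT, ← mul_assoc, hQP, zero_mul]
  have hYQY : A * Q * Y = Y * Q * Y := by
    rw [hS, sub_mul, sub_mul] at hc; exact sub_eq_zero.mp hc
  have hTA : T * A * Q = 0 := by rw [mul_assoc, hAQ, ← mul_assoc, hTQ, zero_mul]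
  have hQA : Q * A * T = 0 := by rw [← hAQ, mul_assoc, hQT, mul_zero]
  -- key vanishing
  have hv : ∀ i, T * Y * Q * A ^ i * Y = 0 := by
    intro i
    induction i with
    | zero =>
      calc T * Y * Q * A ^ 0 * Y = T * (Y * Q * Y) := by simp [mul_assoc]
        _ = T * A * Q * Y := by rw [← hYQY]; simp only [mul_assoc]
        _ = 0 := by rw [hTA, zero_mul]
    | succ i ih =>
      calc T * Y * Q * A ^ (i + 1) * Y = T * Y * (Q * A ^ (i + 1)) * Y := by
            simp only [mul_assoc]
        _ = T * Y * ((Q * Q) * A ^ (i + 1)) * Y := by rw [hQQ]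
        _ = T * Y * Q * (Q * A ^ (i + 1)) * Y := by simp only [mul_assoc]
        _ = T * Y * Q * (A ^ (i + 1) * Q) * Y := by rw [hAiQ]
        _ = T * Y * Q * A ^ i * (A * Q * Y) := by rw [pow_succ]; simp only [mul_assoc]
        _ = (T * Y * Q * A ^ i * Y) * Q * Y := by rw [hYQY]; simp only [mul_assoc]
        _ = 0 := by rw [ih]; simp
  obtain ⟨g, hg⟩ : ∃ g : ℕ → R, g = fun i => T ^ (i + 1) * Y * Q * A ^ i := ⟨_, rfl⟩
  obtain ⟨G, hG⟩ : ∃ G : R, G = ∑ i ∈ Finset.range k, g i := ⟨_, rfl⟩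
  have hgY : ∀ i, g i * Y = 0 := by
    intro i
    calc g i * Y = T ^ i * (T * Y * Q * A ^ i * Y) := by
          rw [hg]; simp only [pow_succ, mul_assoc]
      _ = 0 := by rw [hv, mul_zero]
  have hgQ : ∀ i, g i * Q = g i := by
    intro i
    rw [hg]
    show T ^ (i + 1) * Y * Q * A ^ i * Q = T ^ (i + 1) * Y * Q * A ^ i
    rw [mul_assoc _ (A ^ i) Q, hAiQ, ← mul_assoc, mul_assoc _ Q Q, hQQ]
  have hPg : ∀ i, P * g i = g i := by
    intro i
    rw [hg]
    show P * (T ^ (i + 1) * Y * Q * A ^ i) = T ^ (i + 1) * Y * Q * A ^ i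
    rw [pow_succ']
    simp only [← mul_assoc]
    rw [hPT]
  have hgA : ∀ i, T * (g i * A) = g (i + 1) := by
    intro i
    rw [hg]
    show T * (T ^ (i + 1) * Y * Q * A ^ i * A) = T ^ (i + 1 + 1) * Y * Q * A ^ (i + 1)
    rw [pow_succ' T (i + 1), pow_succ A i]; simp only [mul_assoc]
  have hGY : G * Y = 0 := by
    rw [hG, Finset.sum_mul]; exact Finset.sum_eq_zero fun i _ => hgY i
  have hGQ : G * Q = G := by
    rw [hG, Finset.sum_mul]; exact Finset.sum_congr rfl fun i _ => hgQ i
  have hPG : P * G = G := by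
    rw [hG, Finset.mul_sum]; exact Finset.sum_congr rfl fun i _ => hPg i
  have hGP : G * P = 0 := by rw [← hGQ, mul_assoc, hQP, mul_zero]
  have hgk : g k = 0 := by
    rw [hg]
    show T ^ (k + 1) * Y * Q * A ^ k = 0
    rw [mul_assoc _ Q, ← hAiQ, hk, mul_zero]
  have hg0 : g 0 = T * Y * Q := by rw [hg]; simp
  have hTGS : T * (G * S) = G - T * Y * Q := by
    rw [hS, mul_sub, hGY, sub_zero, hG, Finset.sum_mul, Finset.mul_sum]
    rw [Finset.sum_congr rfl fun i _ => hgA i]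
    have e1 := Finset.sum_range_succ g k
    have e2 := Finset.sum_range_succ' g k
    rw [e1, hgk, add_zero, hg0] at e2
    rw [e2]; abel
  obtain ⟨W, hW⟩ : ∃ W : R, W = P - G := ⟨_, rfl⟩
  obtain ⟨U, hU⟩ : ∃ U : R, U = 1 - Q * Y * T := ⟨_, rfl⟩
  have hWP : W * P = P := by rw [hW, sub_mul, hGP, hPP, sub_zero]
  have hPW : P * W = W := by rw [hW, mul_sub, hPG, hPP]
  have hXU : X = U * T * W := by
    have e : U * T * W = U * T * P - U * (T * G) := by
      rw [hW, mul_sub, mul_assoc U T G]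
    rw [e, hX, hG, Finset.mul_sum, Finset.mul_sum, ← hU, mul_assoc U T P, hTP]
    have e3 : U * T = T - Q * Y * T ^ 2 := by rw [hU, sub_mul, one_mul, pow_two]; simp only [mul_assoc]
    rw [e3]
    have e4 : ∀ i ∈ Finset.range k, U * (T * g i) = U * T ^ (i + 2) * Y * Q * A ^ i := by
      intro i _
      rw [hg]
      show U * (T * (T ^ (i + 1) * Y * Q * A ^ i)) = _
      rw [pow_succ' T (i + 1)]; simp only [mul_assoc]
    rw [Finset.sum_congr rfl e4]; abel
  have hTS : T * S = P - T * Y * Q := by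
    calc T * S = T * S * (P + Q) := by rw [hQ]; simp
      _ = P + T * S * Q := by rw [mul_add, h2]
      _ = P - T * Y * Q := by rw [hS, mul_sub, sub_mul, hTA]; abel
  have hTWS : T * W * S = W := by
    rw [hW, mul_sub, hTP, sub_mul, mul_assoc T G S, hTGS, hTS]; abel
  have hST : S * T = U * P := by
    calc S * T = (P + Q) * (S * T) := by rw [hQ]; simp
      _ = P * S * T + Q * S * T := by rw [add_mul]; simp only [mul_assoc]
      _ = U * P := by
        rw [h1, hS, mul_sub, sub_mul, hQA, hU, sub_mul, mul_assoc (Q * Y) T P, hTP]; simp [sub_eq_add_neg]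
  have hSU : S * U = S := by
    rw [hU, mul_sub, ← mul_assoc, ← mul_assoc, hc]; simp
  have hSX : S * X = U * W := by
    rw [hXU, ← mul_assoc, ← mul_assoc, hSU, hST, mul_assoc, hPW]
  have hXS : X * S = U * W := by
    rw [hXU, mul_assoc, mul_assoc, ← mul_assoc T W S, hTWS]
  have hWQY : W * Q * Y = 0 := by
    rw [hW, sub_mul, hPQ, hGQ, zero_sub, neg_mul, hGY, neg_zero]
  have hWT : W * T = T := by rw [← hPT, ← mul_assoc, hWP]
  have hWU : W * U = W := by
    rw [hU, mul_sub, ← mul_assoc, ← mul_assoc, hWQY]; simp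
  refine ⟨?_, hSX.trans hXS.symm, ?_⟩
  · rw [hXS, hXU, mul_assoc U W, ← mul_assoc W, ← mul_assoc W, hWU, hWT, ← mul_assoc]
  obtain ⟨E, hE⟩ : ∃ E : R, E = 1 - U * W := ⟨_, rfl⟩
  have hES : E * S = S * E := by
    rw [hE, sub_mul, mul_sub, one_mul, mul_one]
    nth_rewrite 1 [← hSX]
    rw [← hXS, mul_assoc]
  have hSE : S * E = S - S * W := by rw [hE, mul_sub, mul_one, ← mul_assoc, hSU]
  have hESP : E * S * P = 0 := by
    rw [hES, hSE, sub_mul, mul_assoc S W P, hWP, sub_self]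
  have hESQ : E * S * Q = E * S := by rw [hQ, mul_sub, hESP]; simp
  have hmain : ∀ l, E * S ^ (l + 1) = E * S * A ^ l * Q := by
    intro l
    induction l with
    | zero => simp [hESQ]
    | succ l ih =>
      have i1 : E * S ^ (l + 1) * Q = E * S ^ (l + 1) := by
        rw [ih, mul_assoc _ Q Q, hQQ]
      have i2 : E * S ^ (l + 1) * Y = 0 := by
        rw [← i1, pow_succ]
        calc E * (S ^ l * S) * Q * Y = E * S ^ l * (S * Q * Y) := by simp only [mul_assoc]
          _ = 0 := by rw [hc, mul_zero]
      calc E * S ^ (l + 1 + 1) = E * S ^ (l + 1) * S := by rw [pow_succ S (l + 1), mul_assoc]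
        _ = E * S ^ (l + 1) * A := by
          nth_rewrite 2 [hS]
          rw [mul_sub, i2, sub_zero]
        _ = E * S * A ^ (l + 1) * Q := by
          rw [ih, mul_assoc _ Q A, ← hAQ, pow_succ]; simp only [mul_assoc]
  have hz : E * S ^ (k + 1) = 0 := by
    rw [hmain, mul_assoc _ (A ^ k) Q, hk, mul_zero]
  have hz2 : S ^ (k + 1) * E = 0 := by
    rw [← hz]; exact (Commute.pow_right (show Commute E S from hES) (k + 1)).symm
  rw [pow_succ, mul_assoc, hSX]
  rw [hE, mul_sub, mul_one] at hz2
  exact (sub_eq_zero.mp hz2).symm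

theorem stmt13
    {p q : Type*} [Fintype p] [DecidableEq p] [Fintype q] [DecidableEq q]
    (A AD : Matrix p p ℂ) (D DD : Matrix q q ℂ)
    (B : Matrix q p ℂ) (C : Matrix p q ℂ)
    (hA : IsDrazinInverse A AD) (hD : IsDrazinInverse D DD)
    (Y S Aπ : Matrix p p ℂ)
    (hY : Y = C * DD * B) (hS : S = A - Y)
    (hAπ : Aπ = 1 - A * AD)
    (Z ZD : Matrix q q ℂ) (hZdef : Z = D - B * AD * C)
    (hZ : IsDrazinInverse Z ZD)
    (K : Matrix p q ℂ) (H : Matrix q p ℂ)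
    (hK : K = AD * C) (hH : H = B * AD)
    (Dπ Zπ : Matrix q q ℂ) (hDπ : Dπ = 1 - D * DD) (hZπ : Zπ = 1 - Z * ZD)
    (T : Matrix p p ℂ) (hT : T = AD + K * ZD * H)
    (hcond1 : K * Dπ * ZD * H = K * DD * Zπ * H)
    (k : ℕ) (hk : A ^ (k + 1) * AD = A ^ k)
    (hcond2 : S * Aπ * Y = 0) :
    IsDrazinInverse S
      (-(∑ i ∈ Finset.range k,
          (1 - Aπ * Y * T) * T ^ (i + 2) * Y * Aπ * A ^ i)
        + T - Aπ * Y * T ^ 2) := by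
  obtain ⟨a1, a2, -⟩ := hA
  obtain ⟨d1, d2, -⟩ := hD
  obtain ⟨z1, z2, -⟩ := hZ
  have hPAD : A * AD * AD = AD := by rw [a2, a1]
  have hADP : AD * (A * AD) = AD := by rw [← Matrix.mul_assoc, a1]
  have hPP : (A * AD) * (A * AD) = A * AD := by
    rw [Matrix.mul_assoc, hADP]
  have hAP : A * (A * AD) = (A * AD) * A := by
    rw [Matrix.mul_assoc A AD A, ← a2]
  have hPT : A * AD * T = T := by
    rw [hT, hK, Matrix.mul_add, hPAD]
    simp only [← Matrix.mul_assoc]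
    rw [hPAD]
  have hTP : T * (A * AD) = T := by
    rw [hT, hH, Matrix.add_mul, hADP]
    simp only [Matrix.mul_assoc]
    rw [hADP]
  have hBC : B * AD * C = D - Z := by rw [hZdef]; abel
  have hc0 : K * (Dπ * ZD - DD * Zπ) * H = 0 := by
    rw [Matrix.mul_sub, Matrix.sub_mul, ← Matrix.mul_assoc, ← Matrix.mul_assoc, hcond1, sub_self]
  have hin : Dπ * ZD - DD * Zπ = ZD - DD - DD * (D - Z) * ZD := by
    rw [hDπ, hZπ, d2]; noncomm_ring
  have hYT : A * AD * Y * T = A * AD * C * DD * H + A * AD * C * (DD * (D - Z) * ZD) * H := by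
    rw [hY, hT, ← hBC, hK, hH, Matrix.mul_add]
    simp only [Matrix.mul_assoc]
  have hAT : A * AD * A * T = A * AD + A * AD * C * ZD * H := by
    have : A * AD * A * T = A * T := by
      rw [← hAP, Matrix.mul_assoc, hPT]
    rw [this, hT, hK, Matrix.mul_add]
    simp only [Matrix.mul_assoc]
  have h1 : A * AD * S * T = A * AD := by
    have e : A * AD * S * T = A * AD + A * (K * (Dπ * ZD - DD * Zπ) * H) := by
      rw [hS, Matrix.mul_sub, Matrix.sub_mul, hYT, hAT, hin, hK]
      simp only [Matrix.mul_sub, Matrix.sub_mul, Matrix.mul_assoc]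
      abel
    rw [e, hc0, Matrix.mul_zero, add_zero]
  have h2 : T * S * (A * AD) = A * AD := by
    obtain ⟨P, hP⟩ : ∃ P, P = A * AD := ⟨_, rfl⟩
    rw [← hP] at hPP hPT hTP h1 ⊢
    have hTQ : P * S * P * T = P := by rw [Matrix.mul_assoc _ P T, hPT, h1]
    have u : (P * S * P + (1 - P)) * (T + (1 - P)) = 1 := by
      have : (P * S * P + (1 - P)) * (T + (1 - P)) =
        P * S * P * T + (P * S * P - P * S * (P * P)) + (T - P * T) + (1 - P - P + P * P) := by
        noncomm_ring
      rw [this, hTQ, hPP, hPT]; simp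
    have v := mul_eq_one_comm.mp u
    have w : (T + (1 - P)) * (P * S * P + (1 - P)) =
        (T * P) * S * P + (T - T * P) + (P * S * P - (P * P) * S * P) + (1 - P - P + P * P) := by
        noncomm_ring
    rw [w, hTP, hPP] at v
    have v' : T * S * P + (1 - P) = 1 := by
      refine Eq.trans ?_ v
      abel
    have := congrArg (fun M => M - (1 - P)) v'
    simpa using this
  have hkk : A ^ k * Aπ = 0 := by
    rw [hAπ, Matrix.mul_sub, Matrix.mul_one, ← Matrix.mul_assoc, ← pow_succ, hk, sub_self]
  obtain ⟨r1, r2, r3⟩ := aux_ring A (A * AD) Y S T Aπ k hS hAπ hPP hAP hPT hTP h1 h2 hkk hcond2 _ rfl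
  exact ⟨r1, r2, k + 1, r3⟩
end
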